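/- For every s ∈ ℂ with Re s > 0, one has e^{−2s} ≠ 1 and Re( (1 + e^{−2s})/(1 − e^{−2s}) − 1/s ) > 0. -/

import Mathlib

namespace Real

theorem sinh_lt_mul_cosh {x : ℝ} (hx : 0 < x) : sinh x < x * cosh x := by
  have hmono : StrictMonoOn (fun t : ℝ => t * cosh t - sinh t) (Set.Ici 0) := by
    refine strictMonoOn_of_hasDerivWithinAt_pos (f' := fun t => t * sinh t)
      (convex_Ici 0) (by fun_prop) (fun t _ => ?_) fun t ht => ?_
    · have h := ((hasDerivAt_id t).mul (hasDerivAt_cosh t)).sub (hasDerivAt_sinh t)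
      exact (h.congr_deriv (by simp)).hasDerivWithinAt
    · rw [interior_Ici, Set.mem_Ioi] at ht
      exact mul_pos ht (sinh_pos_iff.2 ht)
  have h := hmono Set.self_mem_Ici hx.le hx
  simpa using h

theorem mul_sinh_sq_add_sin_sq_lt {x : ℝ} (hx : 0 < x) (y : ℝ) :
    x * (sinh x ^ 2 + sin y ^ 2) < sinh x * cosh x * (x ^ 2 + y ^ 2) := by
  have hsinh : x < sinh x := self_lt_sinh_iff.2 hx
  have hcosh : 1 ≤ cosh x := one_le_cosh x
  have hx_le : x ≤ sinh x * cosh x := by nlinarith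
  have h₁ : x * sinh x * sinh x < x * sinh x * (x * cosh x) :=
    mul_lt_mul_of_pos_left (sinh_lt_mul_cosh hx) (by nlinarith)
  have h₂ : x * sin y ^ 2 ≤ sinh x * cosh x * y ^ 2 :=
    mul_le_mul hx_le sin_sq_le_sq (sq_nonneg _) (hx.le.trans hx_le)
  linarith

end Real

namespace Complex

theorem exp_neg_two_mul_ne_one {s : ℂ} (hs : 0 < s.re) : exp (-2 * s) ≠ 1 := by
  intro h
  have hnorm := congrArg norm h
  rw [norm_exp, norm_one, Real.exp_eq_one_iff] at hnorm
  simp at hnorm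
  exact hs.ne' hnorm

theorem one_add_exp_div_one_sub_exp (s : ℂ) :
    (1 + exp (-2 * s)) / (1 - exp (-2 * s)) = cosh s / sinh s := by
  have hexp : exp (-2 * s) = exp (-s) * exp (-s) := by rw [← exp_add]; ring_nf
  have hinv : exp s * exp (-s) = 1 := by rw [← exp_add, add_neg_cancel, exp_zero]
  have hnum : 1 + exp (-2 * s) = 2 * exp (-s) * cosh s := by
    rw [cosh, hexp]; linear_combination -hinv
  have hden : 1 - exp (-2 * s) = 2 * exp (-s) * sinh s := by
    rw [sinh, hexp]; linear_combination -hinv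
  rw [hnum, hden, mul_div_mul_left _ _ (mul_ne_zero two_ne_zero (exp_ne_zero _))]

theorem sinh_re (s : ℂ) : (sinh s).re = Real.sinh s.re * Real.cos s.im := by
  conv_lhs => rw [← re_add_im s, sinh_add, sinh_mul_I, cosh_mul_I]
  simp [sinh_ofReal_re, cos_ofReal_re]

theorem sinh_im (s : ℂ) : (sinh s).im = Real.cosh s.re * Real.sin s.im := by
  conv_lhs => rw [← re_add_im s, sinh_add, sinh_mul_I, cosh_mul_I]
  simp [sin_ofReal_re]

theorem cosh_re (s : ℂ) : (cosh s).re = Real.cosh s.re * Real.cos s.im := by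
  conv_lhs => rw [← re_add_im s, cosh_add, sinh_mul_I, cosh_mul_I]
  simp [cos_ofReal_re]

theorem cosh_im (s : ℂ) : (cosh s).im = Real.sinh s.re * Real.sin s.im := by
  conv_lhs => rw [← re_add_im s, cosh_add, sinh_mul_I, cosh_mul_I]
  simp [sinh_ofReal_re, sin_ofReal_re]

theorem normSq_sinh (s : ℂ) : normSq (sinh s) = Real.sinh s.re ^ 2 + Real.sin s.im ^ 2 := by
  rw [normSq_apply, sinh_re, sinh_im]
  linear_combination Real.sinh s.re ^ 2 * Real.sin_sq_add_cos_sq s.im +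
    Real.sin s.im ^ 2 * Real.cosh_sq_sub_sinh_sq s.re

theorem cosh_div_sinh_re (s : ℂ) :
    (cosh s / sinh s).re =
      Real.sinh s.re * Real.cosh s.re / (Real.sinh s.re ^ 2 + Real.sin s.im ^ 2) := by
  rw [div_re, ← add_div, normSq_sinh, cosh_re, cosh_im, sinh_re, sinh_im]
  congr 1
  linear_combination Real.sinh s.re * Real.cosh s.re * Real.sin_sq_add_cos_sq s.im

end Complex

/-- For every `s ∈ ℂ` with `Re s > 0`, `e^{−2s} ≠ 1` and
`Re((1 + e^{−2s})/(1 − e^{−2s}) − 1/s) > 0`. -/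
theorem stmt14 (s : ℂ) (hs : 0 < s.re) :
    Complex.exp (-2 * s) ≠ 1 ∧
    0 < ((1 + Complex.exp (-2 * s)) / (1 - Complex.exp (-2 * s)) - 1 / s).re := by
  refine ⟨Complex.exp_neg_two_mul_ne_one hs, ?_⟩
  have hsinh : 0 < Real.sinh s.re := Real.sinh_pos_iff.2 hs
  rw [Complex.one_add_exp_div_one_sub_exp, Complex.sub_re, Complex.cosh_div_sinh_re,
    one_div, Complex.inv_re, Complex.normSq_apply, ← sq, ← sq, sub_pos,
    div_lt_div_iff₀ (by positivity) (by positivity)]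
  exact Real.mul_sinh_sq_add_sin_sq_lt hs s.im
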